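/- arXiv:2310.13317 — 12 statements merged into one kernel-verified Lean document; each statement's English description precedes it below -/
import Mathlib

section
/- For any two integers h and k (positive, negative, or zero), and for every integer N, there exists an integer n > N such that each of the three integers n, n+h, and n+k is a sum of two nonzero squares. -/
/-- `n` is a sum of two squares of distinct positive integers. -/
def IsSumDistinctPosSq (n : ℤ) : Prop :=
  ∃ a b : ℤ, 0 < a ∧ a < b ∧ n = a ^ 2 + b ^ 2

theorem IsSumDistinctPosSq.two_mul {n : ℤ} (hn : IsSumDistinctPosSq n) :
    IsSumDistinctPosSq (2 * n) := by
  obtain ⟨a, b, ha, hab, rfl⟩ := hn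
  exact ⟨b - a, b + a, by linarith, by linarith, by ring⟩

theorem IsSumDistinctPosSq.exists_ne_zero {n : ℤ} (hn : IsSumDistinctPosSq n) :
    ∃ a b : ℤ, a ≠ 0 ∧ b ≠ 0 ∧ n = a ^ 2 + b ^ 2 := by
  obtain ⟨a, b, ha, hab, rfl⟩ := hn
  exact ⟨a, b, ha.ne', (ha.trans hab).ne', rfl⟩

/-- There are arbitrarily large `n` such that `n`, `n + h` and `n + k` are sums of two squares of
distinct positive integers. -/
def HasLargeTriples (h k : ℤ) : Prop :=
  ∀ N : ℤ, ∃ n > N, IsSumDistinctPosSq n ∧ IsSumDistinctPosSq (n + h) ∧ IsSumDistinctPosSq (n + k)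

namespace HasLargeTriples

theorem symm {h k : ℤ} (H : HasLargeTriples h k) : HasLargeTriples k h := fun N ↦
  let ⟨n, hN, h₀, h₁, h₂⟩ := H N
  ⟨n, hN, h₀, h₂, h₁⟩

theorem of_translate {h k : ℤ} (H : HasLargeTriples (-h) (k - h)) : HasLargeTriples h k := by
  intro N
  obtain ⟨n, hN, h₀, h₁, h₂⟩ := H (N + h)
  refine ⟨n - h, by linarith, ?_, ?_, ?_⟩
  · rwa [sub_eq_add_neg]
  · rwa [sub_add_cancel]
  · rwa [show n - h + k = n + (k - h) by ring]

theorem two_mul {h k : ℤ} (H : HasLargeTriples h k) : HasLargeTriples (2 * h) (2 * k) := by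
  intro N
  obtain ⟨n, hN, h₀, h₁, h₂⟩ := H |N|
  refine ⟨2 * n, ?_, h₀.two_mul, ?_, ?_⟩
  · linarith [le_abs_self N, abs_nonneg N]
  · simpa only [mul_add] using h₁.two_mul
  · simpa only [mul_add] using h₂.two_mul

theorem zero : HasLargeTriples 0 0 := by
  intro N
  have hn : IsSumDistinctPosSq (1 ^ 2 + (|N| + 2) ^ 2) :=
    ⟨1, |N| + 2, one_pos, by linarith [abs_nonneg N], rfl⟩
  refine ⟨1 ^ 2 + (|N| + 2) ^ 2, ?_, hn, ?_, ?_⟩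
  · nlinarith [le_abs_self N, abs_nonneg N]
  all_goals simpa only [add_zero] using hn

theorem odd_even (d c : ℤ) : HasLargeTriples (2 * d + 1) (2 * c) := by
  intro N
  obtain ⟨m, hm⟩ : ∃ m : ℤ, m = |d| + |c| + |N| + 10 := ⟨_, rfl⟩
  have hd := abs_le.mp (le_refl |d|)
  have hc := abs_le.mp (le_refl |c|)
  have hN := le_abs_self N
  have hd₀ := abs_nonneg d
  have hc₀ := abs_nonneg c
  have hN₀ := abs_nonneg N
  have hm₀ : 10 ≤ m := by linarith
  obtain ⟨A, hA⟩ : ∃ A : ℤ, A = 4 * m ^ 2 - 2 * m - d - c + 1 := ⟨_, rfl⟩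
  obtain ⟨X, hX⟩ : ∃ X : ℤ, X = 2 * m * A - 2 * m ^ 2 + d := ⟨_, rfl⟩
  have hAm : 3 * m ^ 2 ≤ A := by nlinarith
  have hmm : 10 * m ≤ m ^ 2 := by nlinarith
  have hmA : 20 * A ≤ 2 * m * A := by nlinarith
  refine ⟨A ^ 2 + X ^ 2, ?_, ⟨A, X, ?_, ?_, rfl⟩, ⟨A - 2 * m, X + 1, ?_, ?_, ?_⟩,
    ⟨A + 2 * m - 1, X - 1, ?_, ?_, ?_⟩⟩
  · nlinarith [sq_nonneg X]
  · linarith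
  · linarith
  · linarith
  · linarith
  · rw [hX, hA]; ring
  · linarith
  · linarith
  · rw [hX, hA]; ring

end HasLargeTriples

theorem hasLargeTriples (h k : ℤ) : HasLargeTriples h k := by
  induction hs : h.natAbs + k.natAbs using Nat.strong_induction_on generalizing h k with
  | _ s ih =>
    rcases Int.even_or_odd' h with ⟨d, rfl | rfl⟩ <;> rcases Int.even_or_odd' k with ⟨c, rfl | rfl⟩
    · by_cases h₀ : d = 0 ∧ c = 0
      · obtain ⟨rfl, rfl⟩ := h₀
        exact HasLargeTriples.zero
      · exact (ih _ (by omega) d c rfl).two_mul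
    · exact (HasLargeTriples.odd_even c d).symm
    · exact HasLargeTriples.odd_even d c
    · apply HasLargeTriples.of_translate
      convert HasLargeTriples.odd_even (-d - 1) (c - d) using 1 <;> ring

theorem three_terms_sums_of_two_nonzero_squares (h k : ℤ) (N : ℤ) :
    ∃ n : ℤ, n > N ∧
      (∃ a b : ℤ, a ≠ 0 ∧ b ≠ 0 ∧ n = a ^ 2 + b ^ 2) ∧
      (∃ a b : ℤ, a ≠ 0 ∧ b ≠ 0 ∧ n + h = a ^ 2 + b ^ 2) ∧
      (∃ a b : ℤ, a ≠ 0 ∧ b ≠ 0 ∧ n + k = a ^ 2 + b ^ 2) := by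
  obtain ⟨n, hN, h₀, h₁, h₂⟩ := hasLargeTriples h k N
  exact ⟨n, hN, h₀.exists_ne_zero, h₁.exists_ne_zero, h₂.exists_ne_zero⟩
end

section
/- Let p, q, r be arbitrary integers and define x = 4r(16p^2r^2 + 8pr + 4r^2 + 1)q^2 - 8r(4p^2r^2 - 4p^2r + 2pr + r^2 - p - r)q - 2r(4p^2r - 2p^2 + 2p + r - 1), y = -2(4pr + 1)(16p^2r^2 + 8pr + 4r^2 + 1)q^2 + 4(4pr + 1)(4p^2r^2 - 4p^2r + 2pr + r^2 - p - r)q + 16p^3r^2 - 8p^3r + 8p^2r + 4pr^2 - 2p^2 - 4pr - 1, and n = x^2 + y^2. Then each of the three consecutive integers n-1, n, and n+1 is a sum of two squares. -/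
theorem three_consecutive_sums_of_two_squares (p q r : ℤ)
    (x y n : ℤ)
    (hx : x = 4*r*(16*p^2*r^2 + 8*p*r + 4*r^2 + 1)*q^2
            - 8*r*(4*p^2*r^2 - 4*p^2*r + 2*p*r + r^2 - p - r)*q
            - 2*r*(4*p^2*r - 2*p^2 + 2*p + r - 1))
    (hy : y = -2*(4*p*r + 1)*(16*p^2*r^2 + 8*p*r + 4*r^2 + 1)*q^2
            + 4*(4*p*r + 1)*(4*p^2*r^2 - 4*p^2*r + 2*p*r + r^2 - p - r)*q
            + 16*p^3*r^2 - 8*p^3*r + 8*p^2*r + 4*p*r^2 - 2*p^2 - 4*p*r - 1)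
    (hn : n = x ^ 2 + y ^ 2) :
    (∃ a b : ℤ, n - 1 = a ^ 2 + b ^ 2) ∧
    (∃ a b : ℤ, n = a ^ 2 + b ^ 2) ∧
    (∃ a b : ℤ, n + 1 = a ^ 2 + b ^ 2) := by
  refine ⟨⟨y + 4*r*q + 1, x + 2*(4*p*r + 1)*q + 2*p, ?_⟩, ⟨x, y, hn⟩,
    ⟨y + 2*r, x + (4*p*r + 1), ?_⟩⟩
  · subst hn hx hy
    ring
  · subst hn hx hy
    ring
end

section
/- For every integer m, let p = 17m + 5 and n = (2p^2 + 1)^2. Then n - 1 = (2p^2)^2 + (2p)^2, n = (15(34m^2 + 20m + 3))^2 + (8(34m^2 + 20m + 3))^2, and n + 1 = (2p^2 + 1)^2 + 1^2; in particular, each of the three consecutive integers n-1, n, n+1 is a sum of two nonzero squares. -/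
theorem triple_17m_plus_5 (m : ℤ) (p n : ℤ)
    (hp : p = 17*m + 5) (hn : n = (2*p^2 + 1)^2) :
    n - 1 = (2*p^2)^2 + (2*p)^2 ∧
    n = (15*(34*m^2 + 20*m + 3))^2 + (8*(34*m^2 + 20*m + 3))^2 ∧
    n + 1 = (2*p^2 + 1)^2 + 1^2 ∧
    (∃ a b : ℤ, a ≠ 0 ∧ b ≠ 0 ∧ n - 1 = a ^ 2 + b ^ 2) ∧
    (∃ a b : ℤ, a ≠ 0 ∧ b ≠ 0 ∧ n = a ^ 2 + b ^ 2) ∧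
    (∃ a b : ℤ, a ≠ 0 ∧ b ≠ 0 ∧ n + 1 = a ^ 2 + b ^ 2) := by
  have hp0 : p ≠ 0 := by omega
  have hq : 2*p^2 + 1 = 17*(34*m^2 + 20*m + 3) := by rw [hp]; ring
  have hp1 : 2*p^2 + 1 ≠ 0 := by positivity
  have hq0 : 34*m^2 + 20*m + 3 ≠ 0 := by
    intro h
    exact hp1 (by rw [hq, h, mul_zero])
  have h₁ : n - 1 = (2*p^2)^2 + (2*p)^2 := by rw [hn]; ring
  have h₂ : n = (15*(34*m^2 + 20*m + 3))^2 + (8*(34*m^2 + 20*m + 3))^2 := by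
    rw [hn, hq]; ring
  have h₃ : n + 1 = (2*p^2 + 1)^2 + 1^2 := by rw [hn]; ring
  exact ⟨h₁, h₂, h₃,
    ⟨_, _, by positivity, by positivity, h₁⟩,
    ⟨_, _, mul_ne_zero (by norm_num) hq0, mul_ne_zero (by norm_num) hq0, h₂⟩,
    ⟨_, _, hp1, one_ne_zero, h₃⟩⟩
end

section
/- Let r1, r2, m be nonzero integers with r1^2 ≠ r2^2, let r = (r1^2 + r2^2)m, and let n = (2r(r-1))^2. Then each of the three consecutive integers n, n+1, and n+2 is a sum of two nonzero squares. -/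
theorem triple_from_sum_of_two_squares_multiple (r1 r2 m : ℤ)
    (hr1 : r1 ≠ 0) (hr2 : r2 ≠ 0) (hm : m ≠ 0) (hne : r1^2 ≠ r2^2)
    (r n : ℤ) (hr : r = (r1^2 + r2^2) * m) (hn : n = (2*r*(r-1))^2) :
    (∃ a b : ℤ, a ≠ 0 ∧ b ≠ 0 ∧ n = a ^ 2 + b ^ 2) ∧
    (∃ a b : ℤ, a ≠ 0 ∧ b ≠ 0 ∧ n + 1 = a ^ 2 + b ^ 2) ∧
    (∃ a b : ℤ, a ≠ 0 ∧ b ≠ 0 ∧ n + 2 = a ^ 2 + b ^ 2) := by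
  have h1 : 0 < r1 ^ 2 := by positivity
  have h2 : 0 < r2 ^ 2 := by positivity
  have hr0 : r ≠ 0 := by
    rw [hr]
    exact mul_ne_zero (by omega) hm
  have hr_sub : r - 1 ≠ 0 := by
    intro h
    have hdvd : r1 ^ 2 + r2 ^ 2 ∣ 1 := ⟨m, by linarith⟩
    have := Int.le_of_dvd one_pos hdvd
    omega
  refine ⟨⟨2 * (r - 1) * m * (r1 ^ 2 - r2 ^ 2), 2 * (r - 1) * m * (2 * r1 * r2), ?_, ?_, ?_⟩,
    ⟨2 * r * (r - 1), 1, ?_, one_ne_zero, ?_⟩,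
    ⟨2 * (r * (r - 1)) - 1, 2 * r - 1, by omega, by omega, ?_⟩⟩
  · have := sub_ne_zero.mpr hne
    positivity
  · positivity
  · have hk : 2 * r * (r - 1) = 2 * (r - 1) * m * (r1 ^ 2 + r2 ^ 2) := by
      linear_combination 2 * (r - 1) * hr
    rw [hn, hk]
    ring
  · positivity
  · rw [hn]
    ring
  · rw [hn]
    ring
end

section
/- Let m and r be arbitrary integers and let n = ((4m^2 - 4m + 2)r^2 - (8m^3 - 8m^2 + 2)r + 4m(m + 1)(m - 1)^2)^2. Then each of the four integers n, n+1, n+2, and n+4 is a sum of two squares. -/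
theorem four_integers_sums_of_two_squares (m r : ℤ) (n : ℤ)
    (hn : n = ((4*m^2 - 4*m + 2)*r^2 - (8*m^3 - 8*m^2 + 2)*r
                + 4*m*(m + 1)*(m - 1)^2)^2) :
    (∃ a b : ℤ, n = a ^ 2 + b ^ 2) ∧
    (∃ a b : ℤ, n + 1 = a ^ 2 + b ^ 2) ∧
    (∃ a b : ℤ, n + 2 = a ^ 2 + b ^ 2) ∧
    (∃ a b : ℤ, n + 4 = a ^ 2 + b ^ 2) := by
  subst hn
  refine ⟨⟨_, 0, (add_zero _).symm⟩, ⟨_, 1, rfl⟩,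
    ⟨(4*m - 2)*r^2 - (8*m^2 - 4*m - 2)*r + (4*m^3 - 2*m^2 - 4*m + 1),
      (4*m^2 - 4*m)*r^2 - (8*m^3 - 8*m^2 - 4*m + 2)*r
        + (4*m*(m + 1)*(m - 1)^2 - 2*m^2 + 1), by ring⟩,
    ⟨_, 2, rfl⟩⟩
end

section
/- Let m and r be integers that are both multiples of 5, let x = (4m^2 - 4m + 2)r^2 - (8m^3 - 8m^2 + 2)r + 4m(m + 1)(m - 1)^2, and suppose x ≠ 0. Then with n = x^2, each of the four integers n, n+1, n+2, and n+4 is a sum of two nonzero squares. -/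
theorem four_integers_sums_of_two_nonzero_squares (m r : ℤ)
    (hm : (5 : ℤ) ∣ m) (hr : (5 : ℤ) ∣ r) (x n : ℤ)
    (hx : x = (4*m^2 - 4*m + 2)*r^2 - (8*m^3 - 8*m^2 + 2)*r
                + 4*m*(m + 1)*(m - 1)^2)
    (hx0 : x ≠ 0) (hn : n = x ^ 2) :
    (∃ a b : ℤ, a ≠ 0 ∧ b ≠ 0 ∧ n = a ^ 2 + b ^ 2) ∧
    (∃ a b : ℤ, a ≠ 0 ∧ b ≠ 0 ∧ n + 1 = a ^ 2 + b ^ 2) ∧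
    (∃ a b : ℤ, a ≠ 0 ∧ b ≠ 0 ∧ n + 2 = a ^ 2 + b ^ 2) ∧
    (∃ a b : ℤ, a ≠ 0 ∧ b ≠ 0 ∧ n + 4 = a ^ 2 + b ^ 2) := by
  obtain ⟨k, hk⟩ : (5 : ℤ) ∣ x := by
    obtain ⟨u, rfl⟩ := hm
    obtain ⟨v, rfl⟩ := hr
    rw [hx]
    exact ⟨(4*(5*u)^2 - 4*(5*u) + 2)*(5*v^2) - (8*(5*u)^3 - 8*(5*u)^2 + 2)*v
      + 4*u*(5*u + 1)*(5*u - 1)^2, by ring⟩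
  have hk0 : k ≠ 0 := by
    rintro rfl
    exact hx0 (by simpa using hk)
  refine ⟨⟨3 * k, 4 * k, by simpa using hk0, by simpa using hk0, ?_⟩,
    ⟨x, 1, hx0, one_ne_zero, by rw [hn]; ring⟩,
    ⟨2 * ((2*m - 1)*r^2 + (-4*m^2 + 2*m + 1)*r + 2*m^3 - m^2 - 2*m) + 1,
      2 * ((2*m^2 - 2*m)*r^2 + (-4*m^3 + 4*m^2 + 2*m - 1)*r
        + 2*m*(m + 1)*(m - 1)^2 - m^2) + 1, by lia, by lia, ?_⟩,
    ⟨x, 2, hx0, two_ne_zero, by rw [hn]; ring⟩⟩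
  · rw [hn, hk]
    ring
  · rw [hn, hx]
    ring
end

section
/- For every integer N, there exists an integer n > N such that each of the five integers n, n+1, n+2, n+4, and n+5 is a sum of two nonzero squares. -/
/-- The Pell-type system `b ^ 2 = 10 * k + 1`, `e ^ 2 = 110 * k - 116` has positive solutions with
`k` arbitrarily large. -/
lemma exists_large_pell_solution (m : ℕ) :
    ∃ b e k : ℤ, 0 < b ∧ 0 < e ∧ (m : ℤ) < k ∧ b ^ 2 = 10 * k + 1 ∧ e ^ 2 = 110 * k - 116 := by
  induction m with
  | zero => exact ⟨19, 62, 36, by norm_num⟩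
  | succ m ih =>
    obtain ⟨b, e, k, hb, he, hk, hbk, hek⟩ := ih
    have hbe : 0 < b * e := mul_pos hb he
    refine ⟨199 * b + 60 * e, 660 * b + 199 * e,
      3960 + 39601 * k + 2388 * (b * e) + 360 * e ^ 2, by positivity, by positivity, ?_, ?_, ?_⟩
    · push_cast
      nlinarith [sq_nonneg e]
    · linear_combination 39601 * hbk
    · linear_combination 435600 * hbk + hek

theorem five_integers_sums_of_two_nonzero_squares (N : ℤ) :
    ∃ n : ℤ, n > N ∧
      (∃ a b : ℤ, a ≠ 0 ∧ b ≠ 0 ∧ n = a ^ 2 + b ^ 2) ∧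
      (∃ a b : ℤ, a ≠ 0 ∧ b ≠ 0 ∧ n + 1 = a ^ 2 + b ^ 2) ∧
      (∃ a b : ℤ, a ≠ 0 ∧ b ≠ 0 ∧ n + 2 = a ^ 2 + b ^ 2) ∧
      (∃ a b : ℤ, a ≠ 0 ∧ b ≠ 0 ∧ n + 4 = a ^ 2 + b ^ 2) ∧
      (∃ a b : ℤ, a ≠ 0 ∧ b ≠ 0 ∧ n + 5 = a ^ 2 + b ^ 2) := by
  obtain ⟨b, e, k, hb, he, hk, hbk, hek⟩ := exists_large_pell_solution N.toNat
  have hNk : N < k := by omega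
  have hk0 : 0 < k := by omega
  refine ⟨(5 * k) ^ 2, by nlinarith,
    ⟨3 * k, 4 * k, by omega, by omega, by ring⟩,
    ⟨5 * k, 1, by omega, by norm_num, by ring⟩,
    ⟨5 * k - 1, b, by omega, hb.ne', by linear_combination -hbk⟩,
    ⟨5 * k, 2, by omega, by norm_num, by ring⟩,
    ⟨5 * k - 11, e, by omega, he.ne', by linear_combination -hek⟩⟩
end

section
/- Let α, β, x be integers satisfying β^2 = 2α^2 - 1 and 2x = α^2 - 1. Then x^2 + 2 = (x - 1)^2 + α^2 and x^2 + 5 = (x - 2)^2 + β^2. Moreover, if in addition α^2 ≡ 1 (mod 5) and x ≠ 0, then with n = x^2, each of the five integers n, n+1, n+2, n+4, and n+5 is a sum of two nonzero squares. -/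
theorem pell_gives_five_term_sequence (α β x : ℤ)
    (hβ : β ^ 2 = 2 * α ^ 2 - 1) (hx : 2 * x = α ^ 2 - 1) :
    x ^ 2 + 2 = (x - 1) ^ 2 + α ^ 2 ∧
    x ^ 2 + 5 = (x - 2) ^ 2 + β ^ 2 ∧
    (α ^ 2 ≡ 1 [ZMOD 5] → x ≠ 0 →
      ∀ n : ℤ, n = x ^ 2 →
        (∃ a b : ℤ, a ≠ 0 ∧ b ≠ 0 ∧ n = a ^ 2 + b ^ 2) ∧
        (∃ a b : ℤ, a ≠ 0 ∧ b ≠ 0 ∧ n + 1 = a ^ 2 + b ^ 2) ∧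
        (∃ a b : ℤ, a ≠ 0 ∧ b ≠ 0 ∧ n + 2 = a ^ 2 + b ^ 2) ∧
        (∃ a b : ℤ, a ≠ 0 ∧ b ≠ 0 ∧ n + 4 = a ^ 2 + b ^ 2) ∧
        (∃ a b : ℤ, a ≠ 0 ∧ b ≠ 0 ∧ n + 5 = a ^ 2 + b ^ 2)) := by
  refine ⟨by linarith, by linarith, ?_⟩
  rintro hmod hx0 n rfl
  obtain ⟨k, rfl⟩ : (5 : ℤ) ∣ x := by
    have h := hmod.symm.dvd
    omega
  have hk : k ≠ 0 := by
    rintro rfl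
    simp at hx0
  have hα0 : α ≠ 0 := by
    rintro rfl
    omega
  have hβ0 : β ≠ 0 := by
    rintro rfl
    omega
  refine ⟨⟨3 * k, 4 * k, by omega, by omega, by ring⟩,
    ⟨5 * k, 1, hx0, one_ne_zero, by ring⟩,
    ⟨5 * k - 1, α, by omega, hα0, by linarith⟩,
    ⟨5 * k, 2, hx0, two_ne_zero, by ring⟩,
    ⟨5 * k - 2, β, by omega, hβ0, by linarith⟩⟩
end

section
/- For every integer N, there exist integers α > N and β > 0 satisfying the negative Pell equation β^2 - 2α^2 = -1 together with the congruence condition α^2 ≡ 1 (mod 5). -/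
/-- Multiplication by the unit `99 + 70√2 = (3 + 2√2)^3` preserves the negative Pell equation and
the residue of `α ^ 2` modulo `5`. -/
theorem exists_negative_pell_gt_nat (n : ℕ) :
    ∃ α β : ℤ, α > n ∧ β > 0 ∧ β ^ 2 - 2 * α ^ 2 = -1 ∧ α ^ 2 ≡ 1 [ZMOD 5] := by
  induction n with
  | zero => exact ⟨1, 1, by norm_num, by norm_num, by norm_num, rfl⟩
  | succ n ih =>
    obtain ⟨α, β, hα, hβ, hpell, hmod⟩ := ih
    refine ⟨99 * α + 70 * β, 99 * β + 140 * α, by push_cast; lia, by lia,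
      by linear_combination hpell, ?_⟩
    refine Int.ModEq.trans (Int.modEq_iff_dvd.mpr ?_) hmod
    exact ⟨-(1960 * α ^ 2 + 2772 * α * β + 980 * β ^ 2), by ring⟩

theorem negative_pell_with_congruence (N : ℤ) :
    ∃ α β : ℤ, α > N ∧ β > 0 ∧ β ^ 2 - 2 * α ^ 2 = -1 ∧ α ^ 2 ≡ 1 [ZMOD 5] := by
  obtain ⟨α, β, hα, h⟩ := exists_negative_pell_gt_nat N.toNat
  exact ⟨α, β, by lia, h⟩
end

section
/- For every integer N, there exists an integer n > N such that each of the five terms n, n+4, n+8, n+12, and n+16 of an arithmetic progression with common difference 4 is a sum of two nonzero squares. -/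
/-- The Pell-type equation `y ^ 2 = 10 * x ^ 2 + 71` has arbitrarily large solutions with `5 ∣ x`. -/
theorem exists_large_pell_solution_s12 (M : ℕ) :
    ∃ h y : ℤ, (M : ℤ) < h ∧ 30 < y ∧ y ^ 2 = 10 * (5 * h) ^ 2 + 71 := by
  induction M with
  | zero => exact ⟨799733, 12644889, by norm_num, by norm_num, by norm_num⟩
  | succ M ih =>
    obtain ⟨h, y, hh, hy, e⟩ := ih
    refine ⟨39480499 * h + 2496966 * y, 624241500 * h + 39480499 * y, ?_, ?_, ?_⟩
    · push_cast
      linarith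
    · linarith
    · linear_combination e

theorem five_term_AP_sums_of_two_nonzero_squares (N : ℤ) :
    ∃ n : ℤ, n > N ∧
      (∃ a b : ℤ, a ≠ 0 ∧ b ≠ 0 ∧ n = a ^ 2 + b ^ 2) ∧
      (∃ a b : ℤ, a ≠ 0 ∧ b ≠ 0 ∧ n + 4 = a ^ 2 + b ^ 2) ∧
      (∃ a b : ℤ, a ≠ 0 ∧ b ≠ 0 ∧ n + 8 = a ^ 2 + b ^ 2) ∧
      (∃ a b : ℤ, a ≠ 0 ∧ b ≠ 0 ∧ n + 12 = a ^ 2 + b ^ 2) ∧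
      (∃ a b : ℤ, a ≠ 0 ∧ b ≠ 0 ∧ n + 16 = a ^ 2 + b ^ 2) := by
  obtain ⟨h, y, hh, hy, e⟩ := exists_large_pell_solution_s12 N.toNat
  have h_pos : 0 < h := by omega
  have hN : N < h := by omega
  have hmod : y % 10 = 1 ∨ y % 10 = 9 := by
    have e10 : y ^ 2 % 10 = 1 := by omega
    have hlt : y % 10 < 10 := by omega
    have hge : 0 ≤ y % 10 := by omega
    rw [pow_two, Int.mul_emod] at e10
    generalize y % 10 = r at *
    interval_cases r <;> simp_all
  refine ⟨(5 * h) ^ 2, by nlinarith, ⟨3 * h, 4 * h, by omega, by omega, by ring⟩,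
    ⟨5 * h, 2, by omega, by norm_num, by ring⟩, ?_, ?_,
    ⟨5 * h, 4, by omega, by norm_num, by ring⟩⟩
  · rcases hmod with hm | hm
    · obtain ⟨k, rfl⟩ : ∃ k, y = 10 * k + 1 := ⟨y / 10, by omega⟩
      exact ⟨3 * k, k + 1, by omega, by omega, by linarith⟩
    · obtain ⟨k, rfl⟩ : ∃ k, y = 10 * k - 1 := ⟨y / 10 + 1, by omega⟩
      exact ⟨3 * k, k - 1, by omega, by omega, by linarith⟩
  · rcases hmod with hm | hm
    · obtain ⟨k, rfl⟩ : ∃ k, y = 10 * k + 1 := ⟨y / 10, by omega⟩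
      exact ⟨3 * k + 1, k - 2, by omega, by omega, by linarith⟩
    · obtain ⟨k, rfl⟩ : ∃ k, y = 10 * k - 1 := ⟨y / 10 + 1, by omega⟩
      exact ⟨3 * k - 1, k + 2, by omega, by omega, by linarith⟩
end

section
/- Let α, β, x be integers satisfying β^2 = 3α^2 - 18 and 2x = α^2 - 7. Then x^2 + 8 = (x - 1)^2 + α^2 and x^2 + 12 = (x - 3)^2 + β^2. Moreover, if in addition α^2 ≡ 7 (mod 37) and x ≠ 0, then with n = x^2, each of the five integers n, n+4, n+8, n+12, and n+16 is a sum of two nonzero squares. -/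
theorem generalized_pell_gives_five_term_AP (α β x : ℤ)
    (hβ : β ^ 2 = 3 * α ^ 2 - 18) (hx : 2 * x = α ^ 2 - 7) :
    x ^ 2 + 8 = (x - 1) ^ 2 + α ^ 2 ∧
    x ^ 2 + 12 = (x - 3) ^ 2 + β ^ 2 ∧
    (α ^ 2 ≡ 7 [ZMOD 37] → x ≠ 0 →
      ∀ n : ℤ, n = x ^ 2 →
        (∃ a b : ℤ, a ≠ 0 ∧ b ≠ 0 ∧ n = a ^ 2 + b ^ 2) ∧
        (∃ a b : ℤ, a ≠ 0 ∧ b ≠ 0 ∧ n + 4 = a ^ 2 + b ^ 2) ∧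
        (∃ a b : ℤ, a ≠ 0 ∧ b ≠ 0 ∧ n + 8 = a ^ 2 + b ^ 2) ∧
        (∃ a b : ℤ, a ≠ 0 ∧ b ≠ 0 ∧ n + 12 = a ^ 2 + b ^ 2) ∧
        (∃ a b : ℤ, a ≠ 0 ∧ b ≠ 0 ∧ n + 16 = a ^ 2 + b ^ 2)) := by
  have h8 : x ^ 2 + 8 = (x - 1) ^ 2 + α ^ 2 := by linarith
  have h12 : x ^ 2 + 12 = (x - 3) ^ 2 + β ^ 2 := by linarith
  refine ⟨h8, h12, ?_⟩
  rintro hmod hx0 n rfl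
  obtain ⟨k, rfl⟩ : (37 : ℤ) ∣ x := by
    have := hmod.symm.dvd
    omega
  have hα0 : α ≠ 0 := by
    rintro rfl
    omega
  have hβ0 : β ≠ 0 := by
    rintro rfl
    omega
  exact ⟨⟨35 * k, 12 * k, by omega, by omega, by ring⟩,
    ⟨37 * k, 2, hx0, by norm_num, by ring⟩,
    ⟨37 * k - 1, α, by omega, hα0, h8⟩,
    ⟨37 * k - 3, β, by omega, hβ0, h12⟩,
    ⟨37 * k, 4, hx0, by norm_num, by ring⟩⟩
end

section
/- For every integer N, there exist integers α > N and β > 0 satisfying the generalized Pell equation β^2 - 3α^2 = -18 together with the congruence condition α^2 ≡ 7 (mod 37). -/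
/-- Multiplication by the unit `(2 + √3) ^ 18`, which is `-1` modulo `37`, sends a positive solution
to a larger one and preserves `α ^ 2` modulo `37`. -/
theorem exists_larger_pell_solution {α β : ℤ} (hα : 0 < α) (hβ : 0 < β)
    (h : β ^ 2 - 3 * α ^ 2 = -18) :
    ∃ α' β' : ℤ, α < α' ∧ 0 < β' ∧ β' ^ 2 - 3 * α' ^ 2 = -18 ∧ α' ^ 2 ≡ α ^ 2 [ZMOD 37] := by
  refine ⟨9863382151 * α + 5694626340 * β, 17083879020 * α + 9863382151 * β,
    by linarith, by positivity, by linear_combination h, ?_⟩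
  have hmod : 9863382151 * α + 5694626340 * β ≡ -α [ZMOD 37] :=
    (Int.modEq_iff_dvd.mpr ⟨266577896 * α + 153908820 * β, by ring⟩ : -α ≡ _ [ZMOD 37]).symm
  simpa using hmod.pow 2

theorem generalized_pell_with_congruence (N : ℤ) :
    ∃ α β : ℤ, α > N ∧ β > 0 ∧ β ^ 2 - 3 * α ^ 2 = -18 ∧ α ^ 2 ≡ 7 [ZMOD 37] := by
  have key : ∀ n : ℕ, ∃ α β : ℤ,
      α > n ∧ β > 0 ∧ β ^ 2 - 3 * α ^ 2 = -18 ∧ α ^ 2 ≡ 7 [ZMOD 37] := by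
    intro n
    induction n with
    | zero => exact ⟨9, 15, by norm_num, by norm_num, by norm_num, by decide⟩
    | succ n ih =>
      obtain ⟨α, β, hα, hβ, h, hmod⟩ := ih
      obtain ⟨α', β', hα', hβ', h', hmod'⟩ := exists_larger_pell_solution (by lia) hβ h
      exact ⟨α', β', by push_cast; lia, hβ', h', hmod'.trans hmod⟩
  obtain ⟨α, β, hα, h⟩ := key N.toNat
  exact ⟨α, β, by lia, h⟩
end
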